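/- arXiv:1901.09427 — 8 statements merged into one kernel-verified Lean document; each statement's English description precedes it below -/
import Mathlib

section
/- Let w be a weight function on the goods [m] (each good g has weight w(g) ≥ 0, extended additively to sets), and let P = (P_1,...,P_n) and Q = (Q_1,...,Q_n) be two n-partitions of [m], each satisfying the EF1 condition under w. Then the sequence (w(P_1),...,w(P_n)) (1/2)-majorizes the sequence (w(Q_1),...,w(Q_n)); that is, for every 1 ≤ k ≤ n−1, the sum of the k largest values among w(P_1),...,w(P_n) is at least one half of the sum of the k largest values among w(Q_1),...,w(Q_n) (and the total sums are equal). -/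
open Finset

/-- Weight of a bundle: sum of the weights of its goods. -/
noncomputable def setW {m : ℕ} (w : Fin m → ℝ) (S : Finset (Fin m)) : ℝ := ∑ g ∈ S, w g

/-- An `n`-partition of the goods `[m]`: pairwise disjoint parts covering everything. -/
def IsPartition {m n : ℕ} (P : Fin n → Finset (Fin m)) : Prop :=
  (∀ i j, i ≠ j → Disjoint (P i) (P j)) ∧ Finset.univ.biUnion P = Finset.univ

/-- The EF1 condition under a common weight function `w`. -/
def EF1 {m n : ℕ} (w : Fin m → ℝ) (P : Fin n → Finset (Fin m)) : Prop :=
  ∀ i j, (P j).Nonempty → ∃ g ∈ P j, setW w (P i) ≥ setW w (P j) - w g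

/-- The number of indices below `k` in `Fin n` is `k` when `k ≤ n`. -/
lemma card_filter_val_lt {n k : ℕ} (hk : k ≤ n) :
    (univ.filter (fun i : Fin n => (i : ℕ) < k)).card = k := by
  rw [Fin.card_filter_val_lt, min_eq_right hk]

/-- The first `k` values of a nonnegative antitone sequence sum to at least as much as any
other at most `k` values. -/
lemma sum_le_sum_filter_val_lt {n k : ℕ} (hk₀ : 1 ≤ k) (hk : k ≤ n) {f : Fin n → ℝ}
    (hf : Antitone f) (hf₀ : ∀ i, 0 ≤ f i) {S : Finset (Fin n)} (hS : S.card ≤ k) :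
    ∑ i ∈ S, f i ≤ ∑ i ∈ univ.filter (fun i : Fin n => (i : ℕ) < k), f i := by
  set c := f ⟨k - 1, by omega⟩ with hc
  have hle : ∑ i ∈ S, (f i - c) ≤ ∑ i ∈ univ.filter (fun i : Fin n => (i : ℕ) < k), (f i - c) := by
    calc ∑ i ∈ S, (f i - c) ≤ ∑ i ∈ S, max (f i - c) 0 :=
          sum_le_sum fun i _ => le_max_left _ _
      _ ≤ ∑ i, max (f i - c) 0 :=
          sum_le_sum_of_subset_of_nonneg (subset_univ S) fun i _ _ => le_max_right _ _
      _ = _ := by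
          rw [sum_filter]
          refine sum_congr rfl fun i _ => ?_
          split_ifs with h
          · exact max_eq_left (sub_nonneg.2 (hf (Fin.le_def.2 (by simp; omega))))
          · exact max_eq_right (sub_nonpos.2 (hf (Fin.le_def.2 (by simp; omega))))
  rw [sum_sub_distrib, sum_sub_distrib, sum_const, sum_const, card_filter_val_lt hk,
    nsmul_eq_mul, nsmul_eq_mul] at hle
  have : (S.card : ℝ) * c ≤ k * c :=
    mul_le_mul_of_nonneg_right (by exact_mod_cast hS) (hf₀ _)
  linarith

/-- If the average of an antitone sequence is at least `q`, then so is the average of its first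
`k` values. -/
lemma mul_le_sum_filter_val_lt {n k : ℕ} (hk₀ : 1 ≤ k) (hk : k ≤ n) {f : Fin n → ℝ}
    (hf : Antitone f) {q : ℝ} (hq : n * q ≤ ∑ i, f i) :
    k * q ≤ ∑ i ∈ univ.filter (fun i : Fin n => (i : ℕ) < k), f i := by
  suffices h : 0 ≤ ∑ i ∈ univ.filter (fun i : Fin n => (i : ℕ) < k), (f i - q) by
    rw [sum_sub_distrib, sum_const, card_filter_val_lt hk, nsmul_eq_mul] at h
    linarith
  by_cases hc : q ≤ f ⟨k - 1, by omega⟩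
  · refine sum_nonneg fun i hi => sub_nonneg.2 (hc.trans (hf (Fin.le_def.2 ?_)))
    simp at hi ⊢
    omega
  · have htot : 0 ≤ ∑ i, (f i - q) := by
      rw [sum_sub_distrib, sum_const, card_univ, Fintype.card_fin, nsmul_eq_mul]
      linarith
    rw [← sum_filter_add_sum_filter_not univ (fun i : Fin n => (i : ℕ) < k)] at htot
    have hrest : ∑ i ∈ univ.filter (fun i : Fin n => ¬ (i : ℕ) < k), (f i - q) ≤ 0 := by
      refine sum_nonpos fun i hi => sub_nonpos.2 (le_trans (hf (Fin.le_def.2 ?_)) (not_le.1 hc).le)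
      simp at hi ⊢
      omega
    linarith

/-- The parts of a partition have total weight equal to the weight of all goods. -/
lemma IsPartition.sum_setW {m n : ℕ} {P : Fin n → Finset (Fin m)} (hP : IsPartition P)
    (w : Fin m → ℝ) : ∑ i, setW w (P i) = ∑ g, w g := by
  simp only [setW]
  rw [← hP.2, sum_biUnion fun i _ j _ hij => hP.1 i j hij]

/-- Any at most `k` goods weigh no more than the `k` heaviest parts of a partition. -/
lemma IsPartition.sum_le_sum_filter_val_lt {m n k : ℕ} {w : Fin m → ℝ} (hw : ∀ g, 0 ≤ w g)
    {P : Fin n → Finset (Fin m)} (hP : IsPartition P) {σ : Equiv.Perm (Fin n)}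
    (hσ : Antitone fun i => setW w (P (σ i))) (hk₀ : 1 ≤ k) (hk : k ≤ n)
    {T : Finset (Fin m)} (hT : T.card ≤ k) :
    ∑ g ∈ T, w g ≤ ∑ i ∈ univ.filter (fun i : Fin n => (i : ℕ) < k), setW w (P (σ i)) := by
  have howner : ∀ g, ∃ i, g ∈ P (σ i) := fun g => by
    obtain ⟨i, -, hi⟩ := mem_biUnion.1 (hP.2 ▸ mem_univ g)
    exact ⟨σ.symm i, by simpa using hi⟩
  choose owner howner using howner
  have hsub : T ⊆ (T.image owner).biUnion fun i => P (σ i) := fun g hg =>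
    mem_biUnion.2 ⟨owner g, mem_image_of_mem _ hg, howner g⟩
  calc ∑ g ∈ T, w g ≤ ∑ g ∈ (T.image owner).biUnion fun i => P (σ i), w g :=
        sum_le_sum_of_subset_of_nonneg hsub fun g _ _ => hw g
    _ = ∑ i ∈ T.image owner, setW w (P (σ i)) :=
        sum_biUnion fun i _ j _ hij => hP.1 _ _ (σ.injective.ne hij)
    _ ≤ _ := _root_.sum_le_sum_filter_val_lt hk₀ hk hσ (fun i => sum_nonneg fun g _ => hw g)
        (card_image_le.trans hT)

/-- In an EF1 partition, any `K` parts weigh at most `K.card` times any given part plus the weight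
of some at most `K.card` goods. -/
lemma EF1.exists_sum_le {m n : ℕ} {w : Fin m → ℝ} (hw : ∀ g, 0 ≤ w g)
    {Q : Fin n → Finset (Fin m)} (hQ : IsPartition Q) (hQef1 : EF1 w Q) (i₀ : Fin n)
    (K : Finset (Fin n)) :
    ∃ T : Finset (Fin m), T.card ≤ K.card ∧
      ∑ j ∈ K, setW w (Q j) ≤ K.card * setW w (Q i₀) + ∑ g ∈ T, w g := by
  have hgood : ∀ j, ∃ t ⊆ Q j, t.card ≤ 1 ∧ setW w (Q j) ≤ setW w (Q i₀) + ∑ g ∈ t, w g := by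
    intro j
    rcases (Q j).eq_empty_or_nonempty with h | h
    · exact ⟨∅, empty_subset _, by simp, by
        simpa [h, setW] using sum_nonneg fun g (_ : g ∈ Q i₀) => hw g⟩
    · obtain ⟨g, hg, hle⟩ := hQef1 i₀ j h
      exact ⟨{g}, singleton_subset_iff.2 hg, by simp, by rw [sum_singleton]; linarith⟩
  choose t htQ htcard htle using hgood
  refine ⟨K.biUnion t, ?_, ?_⟩
  · simpa using card_biUnion_le_card_mul K t 1 fun j _ => htcard j
  · rw [sum_biUnion fun i _ j _ hij => (hQ.1 i j hij).mono (htQ i) (htQ j), ← nsmul_eq_mul,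
      ← sum_const, ← sum_add_distrib]
    exact sum_le_sum fun j _ => htle j

/-- any two EF1 partitions (under the same additive weight `w`)
`1/2`-majorize each other. -/
theorem stmt1 {m n : ℕ} (w : Fin m → ℝ) (hw : ∀ g, 0 ≤ w g)
    (P Q : Fin n → Finset (Fin m))
    (hP : IsPartition P) (hQ : IsPartition Q)
    (hPef1 : EF1 w P) (hQef1 : EF1 w Q) :
    (∀ σ τ : Equiv.Perm (Fin n),
      Antitone (fun i => setW w (P (σ i))) → Antitone (fun i => setW w (Q (τ i))) →
      ∀ k : ℕ, 1 ≤ k → k ≤ n - 1 →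
        ∑ i ∈ Finset.univ.filter (fun i : Fin n => (i : ℕ) < k), setW w (P (σ i)) ≥
          (1 / 2) * ∑ i ∈ Finset.univ.filter (fun i : Fin n => (i : ℕ) < k), setW w (Q (τ i))) ∧
    ∑ i, setW w (P i) = ∑ i, setW w (Q i) := by
  refine ⟨fun σ τ hσ _ k hk₀ hk => ?_, (hP.sum_setW w).trans (hQ.sum_setW w).symm⟩
  have hkn : k ≤ n := by omega
  obtain ⟨i₀, -, hmin⟩ := exists_min_image univ (fun i => setW w (Q i)) ⟨⟨0, by omega⟩, mem_univ _⟩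
  obtain ⟨T, hTcard, hT⟩ := hQef1.exists_sum_le hw hQ i₀
    ((univ.filter fun i : Fin n => (i : ℕ) < k).map τ.toEmbedding)
  rw [card_map, card_filter_val_lt hkn] at hTcard hT
  rw [sum_map] at hT
  have hgoods := hP.sum_le_sum_filter_val_lt hw hσ hk₀ hkn hTcard
  have hmean : n * setW w (Q i₀) ≤ ∑ i, setW w (P (σ i)) := by
    rw [Equiv.sum_comp σ fun i => setW w (P i), hP.sum_setW, ← hQ.sum_setW]
    simpa using card_nsmul_le_sum univ (fun i => setW w (Q i)) _ hmin
  have hlow := mul_le_sum_filter_val_lt hk₀ hkn hσ hmean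
  simp only [Equiv.coe_toEmbedding] at hT
  linarith
end

section
/- Let w be a weight function on the goods [m], let v_1 ≥ v_2 ≥ ... ≥ v_n ≥ 0 be real valuation parameters, and let P = (P_1,...,P_n) be an n-partition of [m] satisfying the EF1 condition under w and indexed so that w(P_1) ≥ w(P_2) ≥ ... ≥ w(P_n). Then for every n-partition Q = (Q_1,...,Q_n) of [m] satisfying the EF1 condition under w and every bijection σ of {1,...,n}, one has Σ_{i=1}^n v_i · w(P_i) ≥ (1/2) · Σ_{i=1}^n v_i · w(Q_{σ(i)}). In other words, the sorted allocation of any EF1 partition has social welfare at least one half of the social welfare of any EF1 allocation. -/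
open Finset

lemma setW_nonneg {m : ℕ} {w : Fin m → ℝ} (hw : ∀ g, 0 ≤ w g) (S : Finset (Fin m)) :
    0 ≤ setW w S :=
  Finset.sum_nonneg fun g _ => hw g

lemma IsPartition.exists_mem {m n : ℕ} {P : Fin n → Finset (Fin m)} (hP : IsPartition P)
    (g : Fin m) : ∃ i, g ∈ P i := by
  have h : g ∈ Finset.univ.biUnion P := hP.2 ▸ Finset.mem_univ g
  simpa using h

/-- If no bundle of `Q` weighs less than `a`, then `a` for everyone yields at most the
welfare of the sorted allocation of `P`. -/
lemma sum_mul_const_le_sum_mul_setW {m n : ℕ} (w : Fin m → ℝ)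
    {v : Fin n → ℝ} (hv : Antitone v) (hv0 : ∀ i, 0 ≤ v i)
    {P Q : Fin n → Finset (Fin m)} (hP : IsPartition P) (hQ : IsPartition Q)
    (hPsorted : Antitone (fun i => setW w (P i))) {a : ℝ} (ha : ∀ i, a ≤ setW w (Q i)) :
    ∑ i, v i * a ≤ ∑ i, v i * setW w (P i) := by
  rcases Nat.eq_zero_or_pos n with rfl | hn
  · simp
  have hcheb : (∑ i, v i) * ∑ i, setW w (P i) ≤ n * ∑ i, v i * setW w (P i) := by
    simpa using (hv.monovary hPsorted).sum_mul_sum_le_card_mul_sum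
  have hmin : n * a ≤ ∑ i, setW w (P i) := by
    rw [hP.sum_setW, ← hQ.sum_setW]
    simpa using Finset.card_nsmul_le_sum Finset.univ _ a fun i _ => ha i
  have hmul := mul_le_mul_of_nonneg_left hmin (Finset.sum_nonneg fun i _ => hv0 i :
    (0 : ℝ) ≤ ∑ i, v i)
  rw [← Finset.sum_mul]
  refine le_of_mul_le_mul_left ?_ (Nat.cast_pos.2 hn : (0 : ℝ) < n)
  linarith

/-- Giving each agent at most one good yields at most the welfare of the sorted allocation. -/
lemma sum_mul_good_le_sum_mul_setW {m n : ℕ} {w : Fin m → ℝ} (hw : ∀ g, 0 ≤ w g)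
    {v : Fin n → ℝ} (hv : Antitone v) (hv0 : ∀ i, 0 ≤ v i)
    {P : Fin n → Finset (Fin m)} (hP : IsPartition P)
    (hPsorted : Antitone (fun i => setW w (P i)))
    (N : Finset (Fin n)) {g : Fin n → Fin m} (hg : Set.InjOn g N) :
    ∑ i ∈ N, v i * w (g i) ≤ ∑ i, v i * setW w (P i) := by
  choose f hf using fun i => hP.exists_mem (g i)
  have hrep : ∀ j, ∃ k, j ∈ N.image f →
      (k ∈ N ∧ f k = j) ∧ ∀ i ∈ N, f i = j → v i ≤ v k := by
    intro j
    by_cases hj : j ∈ N.image f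
    · obtain ⟨i, hi, hij⟩ := Finset.mem_image.1 hj
      obtain ⟨k, hk, hmax⟩ := Finset.exists_max_image {i ∈ N | f i = j} v
        ⟨i, Finset.mem_filter.2 ⟨hi, hij⟩⟩
      exact ⟨k, fun _ => ⟨Finset.mem_filter.1 hk,
        fun i hi hij => hmax i (Finset.mem_filter.2 ⟨hi, hij⟩)⟩⟩
    · exact ⟨j, fun h => absurd h hj⟩
  choose r hr using hrep
  have hrinj : Set.InjOn r (N.image f : Finset (Fin n)) := fun i hi j hj hij => by
    rw [← (hr i hi).1.2, hij, (hr j hj).1.2]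
  obtain ⟨e, he⟩ := Finset.exists_equiv_extend_of_card_eq (t := Finset.univ) (by simp)
    (Finset.subset_univ _) hrinj
  let π : Equiv.Perm (Fin n) := e.trans (Equiv.subtypeUnivEquiv fun i => Finset.mem_univ i)
  have hπ : ∀ j ∈ N.image f, π j = r j := he
  calc ∑ i ∈ N, v i * w (g i)
      = ∑ j ∈ N.image f, ∑ i ∈ N with f i = j, v i * w (g i) :=
        (Finset.sum_fiberwise_of_maps_to (fun i hi => Finset.mem_image_of_mem f hi) _).symm
    _ ≤ ∑ j ∈ N.image f, v (π j) * setW w (P j) := by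
        refine Finset.sum_le_sum fun j hj => ?_
        have hfiber : ∑ i ∈ N with f i = j, w (g i) ≤ setW w (P j) := by
          rw [← Finset.sum_image (f := w) (hg.mono (Finset.coe_subset.2 (Finset.filter_subset _ _)))]
          refine Finset.sum_le_sum_of_subset_of_nonneg ?_ fun x _ _ => hw x
          intro x hx
          obtain ⟨i, hi, rfl⟩ := Finset.mem_image.1 hx
          exact (Finset.mem_filter.1 hi).2 ▸ hf i
        refine le_trans ?_ (mul_le_mul_of_nonneg_left hfiber (hv0 _))
        rw [Finset.mul_sum, hπ j hj]
        refine Finset.sum_le_sum fun i hi => ?_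
        obtain ⟨hiN, hij⟩ := Finset.mem_filter.1 hi
        exact mul_le_mul_of_nonneg_right ((hr j hj).2 i hiN hij) (hw _)
    _ ≤ ∑ j, v (π j) * setW w (P j) :=
        Finset.sum_le_sum_of_subset_of_nonneg (Finset.subset_univ _)
          fun j _ _ => mul_nonneg (hv0 _) (setW_nonneg hw _)
    _ ≤ ∑ i, v i * setW w (P i) := (hv.monovary hPsorted).sum_comp_perm_mul_le_sum_mul

/-- the sorted allocation of any EF1 partition achieves social welfare
at least half that of any EF1 allocation. -/
theorem stmt2 {m n : ℕ} (w : Fin m → ℝ) (hw : ∀ g, 0 ≤ w g)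
    (v : Fin n → ℝ) (hv : Antitone v) (hv0 : ∀ i, 0 ≤ v i)
    (P : Fin n → Finset (Fin m)) (hP : IsPartition P) (hPef1 : EF1 w P)
    (hPsorted : Antitone (fun i => setW w (P i))) :
    ∀ Q : Fin n → Finset (Fin m), IsPartition Q → EF1 w Q →
      ∀ σ : Equiv.Perm (Fin n),
        ∑ i, v i * setW w (P i) ≥ (1 / 2) * ∑ i, v i * setW w (Q (σ i)) := by
  intro Q hQ hQef1 σ
  rcases isEmpty_or_nonempty (Fin n) with hn | hn
  · simp
  rcases isEmpty_or_nonempty (Fin m) with hm | hm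
  · simp [setW, fun S : Finset (Fin m) => S.eq_empty_of_isEmpty]
  obtain ⟨i₀, hi₀⟩ := Finite.exists_min fun i => setW w (Q i)
  have hchoice : ∀ i, ∃ g, (Q (σ i)).Nonempty →
      g ∈ Q (σ i) ∧ setW w (Q (σ i)) ≤ setW w (Q i₀) + w g := by
    intro i
    by_cases h : (Q (σ i)).Nonempty
    · obtain ⟨g, hg, hle⟩ := hQef1 i₀ (σ i) h
      exact ⟨g, fun _ => ⟨hg, by linarith⟩⟩
    · exact ⟨Classical.arbitrary _, fun h' => absurd h' h⟩
  choose g hg using hchoice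
  let N : Finset (Fin n) := {i | (Q (σ i)).Nonempty}
  have hN : ∀ i, i ∈ N ↔ (Q (σ i)).Nonempty := by simp [N]
  have hginj : Set.InjOn g N := by
    intro i hi j hj hij
    by_contra hne
    have hi' := (hg i ((hN i).1 hi)).1
    rw [hij] at hi'
    exact Finset.disjoint_left.1 (hQ.1 _ _ (σ.injective.ne hne)) hi' (hg j ((hN j).1 hj)).1
  have hbound : ∑ i, v i * setW w (Q (σ i)) ≤
      ∑ i, v i * setW w (Q i₀) + ∑ i ∈ N, v i * w (g i) := by
    rw [← Finset.univ_inter N, ← Finset.sum_ite_mem, ← Finset.sum_add_distrib]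
    refine Finset.sum_le_sum fun i _ => ?_
    split_ifs with hi
    · rw [← mul_add]
      exact mul_le_mul_of_nonneg_left (hg i ((hN i).1 hi)).2 (hv0 i)
    · rw [hN, Finset.not_nonempty_iff_eq_empty] at hi
      rw [hi, add_zero]
      exact mul_le_mul_of_nonneg_left (by simpa [setW] using setW_nonneg hw (Q i₀)) (hv0 i)
  have hconst := sum_mul_const_le_sum_mul_setW w hv hv0 hP hQ hPsorted hi₀
  have hgood := sum_mul_good_le_sum_mul_setW hw hv hv0 hP hPsorted N hginj
  linarith
end

section
/- Let w be a weight function on the goods [m], let v_1 ≥ v_2 ≥ ... ≥ v_n ≥ 0 be real valuation parameters, let μ be the maximin share, and set H = {g ∈ [m] : w(g) ≥ μ} and L = [m] \ H. The set of n-partitions (S_1,...,S_n) of [m] with w(S_i) ≥ μ for all i is nonempty, and there exists a partition O = (O_1,...,O_n) maximizing Σ_{i=1}^n v_i · w(S_i) over this set such that for every index i ∈ {2,...,n}, either O_i ⊆ L or O_i ⊆ H. -/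
open Finset

/-- `μ` is the maximin share. -/
def IsMaximinShare {m n : ℕ} (w : Fin m → ℝ) (μ : ℝ) : Prop :=
  (∃ P : Fin n → Finset (Fin m), IsPartition P ∧ ∀ j, μ ≤ setW w (P j)) ∧
  (∀ P : Fin n → Finset (Fin m), IsPartition P → ∃ j, setW w (P j) ≤ μ)

theorem IsPartition.transfer {m n : ℕ} {P : Fin n → Finset (Fin m)} (hP : IsPartition P)
    (a : Fin n) (g : Fin m) :
    IsPartition fun j => if j = a then insert g (P j) else (P j).erase g := by
  refine ⟨fun i j hij => ?_, Finset.eq_univ_of_forall fun x => ?_⟩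
  · have hdisj := Finset.disjoint_left.mp (hP.1 i j hij)
    rw [Finset.disjoint_left]
    intro x hxi hxj
    have := @hdisj x
    grind
  · rw [Finset.mem_biUnion]
    by_cases hx : x = g
    · exact ⟨a, Finset.mem_univ _, by simp [hx]⟩
    · obtain ⟨j, -, hj⟩ := Finset.mem_biUnion.mp (hP.2 ▸ Finset.mem_univ x)
      exact ⟨j, Finset.mem_univ _, by grind⟩

theorem IsPartition.setW_transfer {m n : ℕ} {P : Fin n → Finset (Fin m)} (hP : IsPartition P)
    (w : Fin m → ℝ) {a i : Fin n} (hia : i ≠ a) {g : Fin m} (hg : g ∈ P i) (j : Fin n) :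
    setW w (if j = a then insert g (P j) else (P j).erase g) =
      setW w (P j) + (if j = a then w g else 0) - (if j = i then w g else 0) := by
  have hmem : ∀ k, k ≠ i → g ∉ P k := fun k hk =>
    Finset.disjoint_left.mp (hP.1 i k hk.symm) hg
  unfold setW
  by_cases hja : j = a
  · subst hja
    simp [hia.symm, Finset.sum_insert (hmem j hia.symm), add_comm]
  · by_cases hji : j = i
    · subst hji
      simp [hja, Finset.sum_erase_eq_sub hg]
    · simp [hja, hji, Finset.erase_eq_of_notMem (hmem j hji)]

theorem IsPartition.welfare_transfer {m n : ℕ} {P : Fin n → Finset (Fin m)} (hP : IsPartition P)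
    (w : Fin m → ℝ) (v : Fin n → ℝ) {a i : Fin n} (hia : i ≠ a) {g : Fin m} (hg : g ∈ P i) :
    ∑ j, v j * setW w (if j = a then insert g (P j) else (P j).erase g) =
      ∑ j, v j * setW w (P j) + (v a - v i) * w g := by
  simp_rw [hP.setW_transfer w hia hg, mul_sub, mul_add, Finset.sum_sub_distrib,
    Finset.sum_add_distrib]
  simp
  ring

/-- the set of MMS-feasible partitions is nonempty, and some welfare
maximizer `O` over this set is such that every bundle other than the first is entirely
contained in the low-valued goods `L` or entirely contained in the high-valued goods `H`. -/
theorem stmt6 {m n : ℕ} (hn : 1 ≤ n) (w : Fin m → ℝ) (hw : ∀ g, 0 ≤ w g)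
    (v : Fin n → ℝ) (hv : Antitone v) (hv0 : ∀ i, 0 ≤ v i)
    (μ : ℝ) (hμ : IsMaximinShare (n := n) w μ)
    (H L : Finset (Fin m))
    (hH : H = Finset.univ.filter (fun g => μ ≤ w g)) (hL : L = Finset.univ \ H) :
    (∃ S : Fin n → Finset (Fin m), IsPartition S ∧ ∀ i, setW w (S i) ≥ μ) ∧
    ∃ O : Fin n → Finset (Fin m), IsPartition O ∧ (∀ i, setW w (O i) ≥ μ) ∧
      (∀ S : Fin n → Finset (Fin m), IsPartition S → (∀ i, setW w (S i) ≥ μ) →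
        ∑ i, v i * setW w (S i) ≤ ∑ i, v i * setW w (O i)) ∧
      ∀ i : Fin n, i ≠ ⟨0, hn⟩ → O i ⊆ L ∨ O i ⊆ H := by
  classical
  obtain ⟨P, hP, hPμ⟩ := hμ.1
  refine ⟨⟨P, hP, hPμ⟩, ?_⟩
  let F : Finset (Fin n → Finset (Fin m)) :=
    Finset.univ.filter fun S => IsPartition S ∧ ∀ i, setW w (S i) ≥ μ
  have mem_F : ∀ S, S ∈ F ↔ IsPartition S ∧ ∀ i, setW w (S i) ≥ μ := by simp [F]
  obtain ⟨M, hMF, hM⟩ := F.exists_max_image (fun S => ∑ i, v i * setW w (S i))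
    ⟨P, (mem_F P).2 ⟨hP, hPμ⟩⟩
  obtain ⟨O, hO, hOcard⟩ := (F.filter fun S =>
      ∑ i, v i * setW w (M i) ≤ ∑ i, v i * setW w (S i)).exists_max_image
    (fun S => (S ⟨0, hn⟩).card) ⟨M, Finset.mem_filter.2 ⟨hMF, le_rfl⟩⟩
  obtain ⟨hOF, hOM⟩ := Finset.mem_filter.1 hO
  obtain ⟨hOpart, hOμ⟩ := (mem_F O).1 hOF
  refine ⟨O, hOpart, hOμ, fun S hS hSμ => (hM S ((mem_F S).2 ⟨hS, hSμ⟩)).trans hOM, ?_⟩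
  intro i hi
  by_contra! hmixed
  obtain ⟨h, hhO, hhL⟩ := Finset.not_subset.1 hmixed.1
  obtain ⟨l, hlO, hlH⟩ := Finset.not_subset.1 hmixed.2
  have hhH : h ∈ H := by simpa [hL] using hhL
  have hhμ : μ ≤ w h := by simpa [hH] using hhH
  have hne : h ≠ l := fun e => hlH (e ▸ hhH)
  have hl0 : l ∉ O ⟨0, hn⟩ := Finset.disjoint_left.mp (hOpart.1 i _ hi) hlO
  have hvi : v i ≤ v ⟨0, hn⟩ := hv (Fin.mk_le_of_le_val (Nat.zero_le _))
  have hfeas : ∀ j, setW w (if j = ⟨0, hn⟩ then insert l (O j) else (O j).erase l) ≥ μ := by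
    intro j
    by_cases hji : j = i
    · subst hji
      rw [if_neg hi]
      exact hhμ.trans (Finset.single_le_sum (fun g _ => hw g) (Finset.mem_erase.2 ⟨hne, hhO⟩))
    · rw [hOpart.setW_transfer w hi hlO, if_neg hji, sub_zero]
      have := hOμ j
      have := hw l
      split_ifs <;> linarith
  have hcard := hOcard _ (Finset.mem_filter.2
    ⟨(mem_F _).2 ⟨hOpart.transfer ⟨0, hn⟩ l, hfeas⟩, by
      rw [hOpart.welfare_transfer w v hi hlO]
      have := mul_nonneg (sub_nonneg.2 hvi) (hw l)
      linarith⟩)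
  rw [if_pos rfl, Finset.card_insert_of_notMem hl0] at hcard
  omega
end

section
/- Let a_1,...,a_m be positive integers with Σ_{i=1}^m a_i = 2B, and let v > ε > 0 be reals with B + ε > max_i a_i. Consider two agents with valuation parameters v_1 = v and v_2 = v − ε, and m+1 goods with weights w(i) = a_i for 1 ≤ i ≤ m and w(m+1) = B + ε, and set τ = 3Bv + εv − εB. Then there exists a subset S ⊆ {1,...,m} with Σ_{i∈S} a_i = B if and only if there exists a 2-partition (S_1, S_2) of {1,...,m+1} satisfying the EF1 condition under w with v_1 · w(S_1) + v_2 · w(S_2) ≥ τ. -/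
open Finset

theorem setW_compl {m : ℕ} (w : Fin m → ℝ) (T : Finset (Fin m)) :
    setW w Tᶜ = ∑ g, w g - setW w T :=
  eq_sub_of_add_eq (Finset.sum_compl_add_sum T w)

theorem isPartition_compl {m : ℕ} (T : Finset (Fin m)) : IsPartition ![Tᶜ, T] := by
  constructor
  · intro i j hij
    fin_cases i <;> fin_cases j <;> simp_all [disjoint_compl_left, disjoint_compl_right]
  · ext g
    simp [em', Fin.exists_fin_two]

theorem IsPartition.eq_compl {m : ℕ} {P : Fin 2 → Finset (Fin m)} (hP : IsPartition P) :
    P 0 = (P 1)ᶜ := by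
  ext g
  have hd : g ∈ P 0 → g ∉ P 1 := fun h => Finset.disjoint_left.mp (hP.1 0 1 (by decide)) h
  have hc : g ∈ Finset.univ.biUnion P := by simp [hP.2]
  simp only [Finset.mem_biUnion, Finset.mem_univ, true_and, Fin.exists_fin_two] at hc
  rw [Finset.mem_compl]
  tauto

/-- correctness of the reduction from the partition problem to welfare
maximization under EF1 constraints.  The integers `a₁,…,a_m` admit a balanced partition
iff the constructed two-agent EF1 instance admits an EF1 allocation of welfare `≥ τ`. -/
theorem stmt9 {m : ℕ} (a : Fin m → ℕ) (ha : ∀ i, 0 < a i) (B : ℕ)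
    (hsum : ∑ i, a i = 2 * B)
    (v ε : ℝ) (hε : 0 < ε) (hvε : ε < v)
    (hmax : ∀ i, (a i : ℝ) < (B : ℝ) + ε)
    (w : Fin (m + 1) → ℝ)
    (hw1 : ∀ i : Fin m, w i.castSucc = (a i : ℝ))
    (hw2 : w (Fin.last m) = (B : ℝ) + ε)
    (τ : ℝ) (hτ : τ = 3 * B * v + ε * v - ε * B) :
    (∃ S : Finset (Fin m), ∑ i ∈ S, a i = B) ↔
    (∃ S : Fin 2 → Finset (Fin (m + 1)), IsPartition S ∧ EF1 w S ∧
      v * setW w (S 0) + (v - ε) * setW w (S 1) ≥ τ) := by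
  have hsumR : ∑ i, (a i : ℝ) = 2 * B := by exact_mod_cast hsum
  have htot : ∑ g, w g = 3 * B + ε := by
    rw [Fin.sum_univ_castSucc]
    simp only [hw1, hw2, hsumR]
    ring
  have hB : (0 : ℝ) ≤ B := B.cast_nonneg
  have hnn : ∀ g, 0 ≤ w g := by
    intro g
    induction g using Fin.lastCases with
    | last => rw [hw2]; linarith
    | cast i => rw [hw1]; exact Nat.cast_nonneg _
  have hle : ∀ g, w g ≤ B + ε := by
    intro g
    induction g using Fin.lastCases with
    | last => exact hw2.le
    | cast i => rw [hw1]; exact (hmax i).le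
  have hmap : ∀ S : Finset (Fin m), setW w (S.map Fin.castSuccEmb) = ((∑ i ∈ S, a i : ℕ) : ℝ) := by
    intro S
    simp [setW, hw1]
  constructor
  · rintro ⟨S, hS⟩
    have hT : setW w (S.map Fin.castSuccEmb) = B := by rw [hmap, hS]
    have hTc : setW w (S.map Fin.castSuccEmb)ᶜ = 2 * B + ε := by
      rw [setW_compl, htot, hT]; ring
    have hlast : Fin.last m ∈ (S.map Fin.castSuccEmb)ᶜ := by
      simp [Fin.castSucc_ne_last]
    refine ⟨![(S.map Fin.castSuccEmb)ᶜ, S.map Fin.castSuccEmb], isPartition_compl _, ?_, ?_⟩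
    · have hself : ∀ T : Finset (Fin (m + 1)), T.Nonempty →
          ∃ g ∈ T, setW w T ≥ setW w T - w g :=
        fun T ⟨g, hg⟩ => ⟨g, hg, sub_le_self _ (hnn g)⟩
      rw [EF1, Fin.forall_fin_two, Fin.forall_fin_two, Fin.forall_fin_two]
      refine ⟨⟨hself _, ?_⟩, ?_, hself _⟩
      · rintro ⟨g, hg⟩
        refine ⟨g, hg, ?_⟩
        simp only [Matrix.cons_val_zero, Matrix.cons_val_one, hT, hTc]
        linarith [hnn g]
      · intro _
        refine ⟨Fin.last m, hlast, ?_⟩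
        simp only [Matrix.cons_val_zero, Matrix.cons_val_one, hT, hTc, hw2]
        linarith
    · simp only [Matrix.cons_val_zero, Matrix.cons_val_one, hT, hTc, hτ]
      linarith
  · rintro ⟨P, hP, hEF, hwel⟩
    have h0 : setW w (P 0) = 3 * B + ε - setW w (P 1) := by
      rw [hP.eq_compl, setW_compl, htot]
    have hub : setW w (P 1) ≤ B := by
      rw [h0, hτ] at hwel
      refine le_of_mul_le_mul_left ?_ hε
      linarith
    have hne : (P 0).Nonempty := by
      rw [Finset.nonempty_iff_ne_empty]
      intro h
      rw [h] at h0
      simp only [setW, Finset.sum_empty] at h0 hub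
      linarith
    obtain ⟨g, -, hg⟩ := hEF 1 0 hne
    have hEq : setW w (P 1) = B := by linarith [hle g]
    have hlast : Fin.last m ∉ P 1 := by
      intro h
      have hwl : w (Fin.last m) ≤ setW w (P 1) :=
        Finset.single_le_sum (fun g _ => hnn g) h
      linarith
    refine ⟨Finset.univ.filter fun i => i.castSucc ∈ P 1, ?_⟩
    have himg : (Finset.univ.filter fun i : Fin m => i.castSucc ∈ P 1).map Fin.castSuccEmb
        = P 1 := by
      ext g
      induction g using Fin.lastCases with
      | last => simp [hlast, Fin.castSucc_ne_last]
      | cast i => simp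
    have h := hmap (Finset.univ.filter fun i => i.castSucc ∈ P 1)
    rw [himg, hEq] at h
    exact_mod_cast h.symm
end

section
/- Let G = (V, E) be a finite simple graph and let ε > 0. Consider the fair-division instance with goods V and agents indexed by {0} ∪ E, where agent 0 has additive valuation v_0(u) = 1 for every u ∈ V, and for each edge e = (u_j, u_k) ∈ E agent e has additive valuation v_e(u_j) = v_e(u_k) = ε and v_e(u) = 0 for u ∉ {u_j, u_k}. Then in every allocation of V to the agents that satisfies the EF1 condition (with respect to these heterogeneous additive valuations), the bundle S_0 allocated to agent 0 is an independent set of G. -/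
open Finset

/-- Valuations in the instance constructed from a graph `G`: agent `none` (agent 0)
values every vertex at `1`; the agent of an edge `e` values the endpoints of `e` at `ε`
and every other vertex at `0`. -/
noncomputable def graphVal {V : Type*} [Fintype V] [DecidableEq V] (G : SimpleGraph V)
    [DecidableRel G.Adj] (ε : ℝ) :
    Option {e : Sym2 V // e ∈ G.edgeFinset} → V → ℝ :=
  fun i u =>
    match i with
    | none => 1
    | some e => if u ∈ e.1 then ε else 0

/-- in every EF1 allocation of the instance constructed from `G`,
the bundle of agent 0 is an independent set of `G`. -/
theorem stmt10 {V : Type*} [Fintype V] [DecidableEq V] (G : SimpleGraph V)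
    [DecidableRel G.Adj] (ε : ℝ) (hε : 0 < ε)
    (S : Option {e : Sym2 V // e ∈ G.edgeFinset} → Finset V)
    (hdisj : ∀ i j, i ≠ j → Disjoint (S i) (S j))
    (hcover : ∀ u : V, ∃ i, u ∈ S i)
    (hEF1 : ∀ i j, (S j).Nonempty → ∃ g ∈ S j,
      ∑ u ∈ S i, graphVal G ε i u ≥ (∑ u ∈ S j, graphVal G ε i u) - graphVal G ε i g) :
    ∀ u ∈ S none, ∀ u' ∈ S none, ¬ G.Adj u u' := by
  intro u hu w hw hadj
  let e : {e : Sym2 V // e ∈ G.edgeFinset} := ⟨s(u, w), by simpa using hadj⟩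
  obtain ⟨g, -, h⟩ := hEF1 (some e) none ⟨u, hu⟩
  have hg : graphVal G ε (some e) g ≤ ε := by
    simp only [graphVal]
    split_ifs <;> linarith
  have hown : ∑ x ∈ S (some e), graphVal G ε (some e) x = 0 := by
    refine Finset.sum_eq_zero fun x hx => ?_
    have hx0 : x ∉ S none := Finset.disjoint_left.mp (hdisj _ _ (by simp)) hx
    have hxe : x ∉ s(u, w) := by
      rw [Sym2.mem_iff]
      rintro (rfl | rfl) <;> contradiction
    exact if_neg hxe
  have hother : ε + ε ≤ ∑ x ∈ S none, graphVal G ε (some e) x := by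
    calc ε + ε = ∑ x ∈ {u, w}, graphVal G ε (some e) x := by
          rw [Finset.sum_pair hadj.ne]
          simp [graphVal, e]
      _ ≤ _ := by
          refine Finset.sum_le_sum_of_subset_of_nonneg ?_ fun x _ _ => ?_
          · simp [Finset.insert_subset_iff, hu, hw]
          · simp only [graphVal]
            split_ifs <;> linarith
  linarith
end

section
/- Let G = (V, E) be a finite simple graph and let ε > 0 satisfy 2ε·|E| < 1. In the fair-division instance with goods V and agents {0} ∪ E, where agent 0 values every vertex at 1 and each edge-agent e = (u_j,u_k) values u_j and u_k at ε and all other vertices at 0, let SW* denote the maximum of Σ_i v_i(S_i) over all allocations satisfying the EF1 condition. Then for every natural number t, the maximum independent set of G has size t if and only if t ≤ SW* < t + 1. -/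
open Finset

/-- An allocation of the vertices to the agents of the graph instance. -/
def IsAlloc {V : Type*} [Fintype V] [DecidableEq V] (G : SimpleGraph V)
    [DecidableRel G.Adj]
    (S : Option {e : Sym2 V // e ∈ G.edgeFinset} → Finset V) : Prop :=
  (∀ i j, i ≠ j → Disjoint (S i) (S j)) ∧ ∀ u : V, ∃ i, u ∈ S i

/-- The EF1 condition for the graph instance. -/
noncomputable def GraphEF1 {V : Type*} [Fintype V] [DecidableEq V] (G : SimpleGraph V)
    [DecidableRel G.Adj] (ε : ℝ)
    (S : Option {e : Sym2 V // e ∈ G.edgeFinset} → Finset V) : Prop :=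
  ∀ i j, (S j).Nonempty → ∃ g ∈ S j,
    ∑ u ∈ S i, graphVal G ε i u ≥ (∑ u ∈ S j, graphVal G ε i u) - graphVal G ε i g

section

variable {V : Type*} [Fintype V] [DecidableEq V] {G : SimpleGraph V} [DecidableRel G.Adj] {ε : ℝ}

lemma graphVal_nonneg (hε : 0 < ε) (i : Option {e : Sym2 V // e ∈ G.edgeFinset}) (u : V) :
    0 ≤ graphVal G ε i u := by
  cases i with
  | none => simp [graphVal]
  | some e => simp only [graphVal]; split_ifs <;> linarith

lemma graphVal_some_le (hε : 0 < ε) (e : {e : Sym2 V // e ∈ G.edgeFinset}) (u : V) :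
    graphVal G ε (some e) u ≤ ε := by
  simp only [graphVal]
  split_ifs <;> linarith

lemma sum_graphVal_none (T : Finset V) : ∑ u ∈ T, graphVal G ε none u = (#T : ℝ) := by
  simp [graphVal]

lemma sum_graphVal_some_le (hε : 0 < ε) (e : {e : Sym2 V // e ∈ G.edgeFinset}) (T : Finset V) :
    ∑ u ∈ T, graphVal G ε (some e) u ≤ 2 * ε := by
  obtain ⟨e, he⟩ := e
  induction e with | _ a b
  have hcard : #(T.filter (· ∈ s(a, b))) ≤ 2 := by
    refine (card_le_card fun x hx => ?_).trans (card_le_two (a := a) (b := b))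
    simpa using (mem_filter.1 hx).2
  simp only [graphVal, ← sum_filter, sum_const, nsmul_eq_mul]
  gcongr
  exact_mod_cast hcard

/-- In an EF1 allocation the bundle of agent 0 is independent. -/
lemma GraphEF1.not_adj_of_mem_none (hε : 0 < ε)
    {S : Option {e : Sym2 V // e ∈ G.edgeFinset} → Finset V} (hA : IsAlloc G S)
    (hS : GraphEF1 G ε S) {u u' : V} (hu : u ∈ S none) (hu' : u' ∈ S none) : ¬ G.Adj u u' := by
  intro hadj
  let e : {e : Sym2 V // e ∈ G.edgeFinset} := ⟨s(u, u'), by simpa using hadj⟩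
  obtain ⟨g, -, h⟩ := hS (some e) none ⟨u, hu⟩
  have hdisj := hA.1 (some e) none (by simp)
  have hzero : ∑ w ∈ S (some e), graphVal G ε (some e) w = 0 := by
    refine sum_eq_zero fun w hw => if_neg fun hwe => ?_
    rcases Sym2.mem_iff.1 hwe with rfl | rfl
    · exact disjoint_left.1 hdisj hw hu
    · exact disjoint_left.1 hdisj hw hu'
  have htwo : ε + ε ≤ ∑ w ∈ S none, graphVal G ε (some e) w := by
    have hsub : ({u, u'} : Finset V) ⊆ S none := by
      simp [insert_subset_iff, hu, hu']
    have hle := sum_le_sum_of_subset_of_nonneg hsub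
      fun w _ _ => graphVal_nonneg hε (some e) w
    rw [sum_pair hadj.ne] at hle
    simpa [graphVal, e] using hle
  linarith [graphVal_some_le hε e g]

lemma welfare_lt (hε : 0 < ε) (hεE : 2 * ε * (#G.edgeFinset : ℝ) < 1)
    (S : Option {e : Sym2 V // e ∈ G.edgeFinset} → Finset V) :
    ∑ i, ∑ u ∈ S i, graphVal G ε i u < #(S none) + 1 := by
  rw [Fintype.sum_option, sum_graphVal_none]
  have h := sum_le_sum fun e (_ : e ∈ univ) => sum_graphVal_some_le hε e (S (some e))
  simp only [sum_const, card_univ, Fintype.card_coe, nsmul_eq_mul] at h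
  linarith

/-- A maximum independent set is the bundle of agent 0 in some EF1 allocation: every other vertex
is given to an edge joining it to the independent set. -/
lemma exists_graphEF1_of_isMax (hε : 0 < ε) {I : Finset V}
    (hI : ∀ u ∈ I, ∀ u' ∈ I, ¬ G.Adj u u')
    (hmax : ∀ s : Finset V, (∀ u ∈ s, ∀ u' ∈ s, ¬ G.Adj u u') → #s ≤ #I) :
    ∃ S, IsAlloc G S ∧ GraphEF1 G ε S ∧ S none = I := by
  have hnbr : ∀ v, ∃ w, v ∉ I → w ∈ I ∧ G.Adj v w := by
    intro v
    by_contra! h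
    have hv : v ∉ I := (h v).1
    have hle := hmax (insert v I) (by
      intro u hu u' hu'
      rw [mem_insert] at hu hu'
      rcases hu with rfl | hu <;> rcases hu' with rfl | hu'
      · exact G.irrefl
      · exact (h u').2 hu'
      · exact fun hadj => (h u).2 hu hadj.symm
      · exact hI u hu u' hu')
    rw [card_insert_of_notMem hv] at hle
    omega
  choose f hf using hnbr
  let S : Option {e : Sym2 V // e ∈ G.edgeFinset} → Finset V
    | none => I
    | some e => univ.filter fun v => v ∉ I ∧ e.1 = s(v, f v)
  have hSome : ∀ e v, v ∈ S (some e) ↔ v ∉ I ∧ e.1 = s(v, f v) := by simp [S]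
  refine ⟨S, ⟨?_, fun v => ?_⟩, ?_, rfl⟩
  · rintro (_ | e) (_ | e') hne
    · exact absurd rfl hne
    · exact disjoint_left.2 fun v hv hv' => ((hSome _ _).1 hv').1 hv
    · exact disjoint_left.2 fun v hv hv' => ((hSome _ _).1 hv).1 hv'
    · refine disjoint_left.2 fun v hv hv' => hne (congrArg some (Subtype.ext ?_))
      exact ((hSome _ _).1 hv).2.trans ((hSome _ _).1 hv').2.symm
  · by_cases hv : v ∈ I
    · exact ⟨none, hv⟩
    · exact ⟨some ⟨s(v, f v), by simpa using (hf v hv).2⟩, (hSome _ _).2 ⟨hv, rfl⟩⟩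
  · rintro i (_ | e) ⟨g, hg⟩
    · rcases i with _ | e
      · exact ⟨g, hg, by simp [graphVal]⟩
      · by_cases hx : ∃ x ∈ I, x ∈ e.1
        · obtain ⟨x, hxI, hxe⟩ := hx
          refine ⟨x, hxI, ?_⟩
          have hsingle : ∑ u ∈ S none, graphVal G ε (some e) u = graphVal G ε (some e) x := by
            refine sum_eq_single_of_mem x hxI fun y hy hyx => if_neg fun hye => hI x hxI y hy ?_
            have he := e.2
            rwa [(Sym2.mem_and_mem_iff hyx.symm).1 ⟨hxe, hye⟩, SimpleGraph.mem_edgeFinset,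
              SimpleGraph.mem_edgeSet] at he
          rw [hsingle, sub_self]
          exact sum_nonneg fun u _ => graphVal_nonneg hε _ u
        · push Not at hx
          refine ⟨g, hg, ?_⟩
          have hzero : ∑ u ∈ S none, graphVal G ε (some e) u = 0 :=
            sum_eq_zero fun u hu => if_neg (hx u hu)
          have hsum := sum_nonneg fun u (_ : u ∈ S (some e)) => graphVal_nonneg hε (some e) u
          linarith [graphVal_nonneg hε (some e) g]
    · refine ⟨g, hg, ?_⟩
      have hsingle : S (some e) = {g} := by
        refine eq_singleton_iff_unique_mem.2 ⟨hg, fun v hv => ?_⟩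
        obtain ⟨hgI, hge⟩ := (hSome _ _).1 hg
        obtain ⟨hvI, hve⟩ := (hSome _ _).1 hv
        rcases Sym2.eq_iff.1 (hve.symm.trans hge) with h | h
        · exact h.1
        · exact absurd (h.1 ▸ (hf g hgI).1) hvI
      rw [hsingle, sum_singleton, sub_self]
      exact sum_nonneg fun u _ => graphVal_nonneg hε _ u

end

/-- if `SW*` is the maximum social welfare over EF1 allocations of the
instance constructed from `G` (with `2ε|E| < 1`), then the maximum independent set of
`G` has size `t` iff `t ≤ SW* < t + 1`. -/
theorem stmt12 {V : Type*} [Fintype V] [DecidableEq V] (G : SimpleGraph V)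
    [DecidableRel G.Adj] (ε : ℝ) (hε : 0 < ε)
    (hεE : 2 * ε * (G.edgeFinset.card : ℝ) < 1)
    (SWstar : ℝ)
    (hSW : IsGreatest {x : ℝ | ∃ S : Option {e : Sym2 V // e ∈ G.edgeFinset} → Finset V,
      IsAlloc G S ∧ GraphEF1 G ε S ∧ x = ∑ i, ∑ u ∈ S i, graphVal G ε i u} SWstar)
    (t : ℕ) :
    IsGreatest {k : ℕ | ∃ s : Finset V,
        (∀ u ∈ s, ∀ u' ∈ s, ¬ G.Adj u u') ∧ s.card = k} t ↔
      ((t : ℝ) ≤ SWstar ∧ SWstar < t + 1) := by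
  obtain ⟨I, hImem, hImax⟩ := exists_max_image
    (univ.filter fun s : Finset V => ∀ u ∈ s, ∀ u' ∈ s, ¬ G.Adj u u') card ⟨∅, by simp⟩
  simp only [mem_filter, mem_univ, true_and] at hImem hImax
  have hgreatest : IsGreatest {k : ℕ | ∃ s : Finset V,
      (∀ u ∈ s, ∀ u' ∈ s, ¬ G.Adj u u') ∧ s.card = k} #I :=
    ⟨⟨I, hImem, rfl⟩, by rintro _ ⟨s, hs, rfl⟩; exact hImax s hs⟩
  have hlow : (#I : ℝ) ≤ SWstar := by
    obtain ⟨S, hA, hS, hnone⟩ := exists_graphEF1_of_isMax hε hImem hImax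
    refine le_trans ?_ (hSW.2 ⟨S, hA, hS, rfl⟩)
    rw [Fintype.sum_option, sum_graphVal_none, hnone]
    exact le_add_of_nonneg_right
      (sum_nonneg fun e _ => sum_nonneg fun u _ => graphVal_nonneg hε _ u)
  have hupp : SWstar < #I + 1 := by
    obtain ⟨S, hA, hS, rfl⟩ := hSW.1
    have hcard : (#(S none) : ℝ) ≤ #I := by
      exact_mod_cast hImax _ fun u hu u' hu' => hS.not_adj_of_mem_none hε hA hu hu'
    linarith [welfare_lt hε hεE S]
  constructor
  · intro ht
    rw [ht.unique hgreatest]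
    exact ⟨hlow, hupp⟩
  · rintro ⟨h₁, h₂⟩
    have h₃ : t < #I + 1 := by exact_mod_cast h₁.trans_lt hupp
    have h₄ : #I < t + 1 := by exact_mod_cast hlow.trans_lt h₂
    rwa [show t = #I by omega]
end

section
/- Let w_1,...,w_m be positive reals and set T = (1/2)·Σ_{j=1}^m w_j. Consider m+3 goods with weights w(j) = w_j for 1 ≤ j ≤ m, w(m+1) = w(m+2) = 3T, and w(m+3) = 4T, three agents with valuation parameters v_1 = 1, v_2 = v_3 = 0, and let μ be the maximin share for 3 agents. Then there exists a 3-partition (A_1, A_2, A_3) of {1,...,m+3} with w(A_i) ≥ μ/4 for all i and v_1·w(A_1) + v_2·w(A_2) + v_3·w(A_3) ≥ 10T if and only if there exists a subset S ⊆ {1,...,m} with Σ_{j∈S} w_j = T. -/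
open Finset

/-- The color classes of a coloring of the goods form a partition. -/
lemma isPartition_colorClasses {m n : ℕ} (f : Fin m → Fin n) :
    IsPartition (fun i => univ.filter (fun g => f g = i)) := by
  refine ⟨fun i j hij => ?_, ?_⟩
  · rw [Finset.disjoint_left]
    intro g hi hj
    simp only [mem_filter, mem_univ, true_and] at hi hj
    exact hij (hi.symm.trans hj)
  · ext g
    simp

/-- Split the weight of a bundle between the first `m` goods and the last three. -/
lemma setW_eq_add_last_three {m : ℕ} (W : Fin (m + 3) → ℝ) (A : Finset (Fin (m + 3))) :
    setW W A = ∑ j ∈ univ.filter (fun j : Fin m => Fin.castAdd 3 j ∈ A), W (Fin.castAdd 3 j)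
      + ((if Fin.natAdd m (0 : Fin 3) ∈ A then W (Fin.natAdd m 0) else 0)
      + (if Fin.natAdd m (1 : Fin 3) ∈ A then W (Fin.natAdd m 1) else 0)
      + (if Fin.natAdd m (2 : Fin 3) ∈ A then W (Fin.natAdd m 2) else 0)) := by
  have h : setW W A = ∑ g, if g ∈ A then W g else 0 := by
    simp [setW]
  rw [h, Fin.sum_univ_add, Fin.sum_univ_three, Finset.sum_filter]

/-- Color the first `m` goods `1` or `2` according to membership in `S`, the last three by `c`. -/
def splitColoring {m : ℕ} (S : Finset (Fin m)) (c : Fin 3 → Fin 3) : Fin (m + 3) → Fin 3 :=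
  Fin.addCases (fun j => if j ∈ S then 1 else 2) c

/-- Weights of the color classes of `splitColoring`. -/
lemma setW_splitColoring {m : ℕ} (W : Fin (m + 3) → ℝ) (S : Finset (Fin m))
    (c : Fin 3 → Fin 3) (i : Fin 3) :
    setW W (univ.filter (fun g => splitColoring S c g = i)) =
      ∑ j ∈ univ.filter (fun j : Fin m => (if j ∈ S then (1 : Fin 3) else 2) = i),
        W (Fin.castAdd 3 j)
      + ((if c 0 = i then W (Fin.natAdd m 0) else 0)
      + (if c 1 = i then W (Fin.natAdd m 1) else 0)
      + (if c 2 = i then W (Fin.natAdd m 2) else 0)) := by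
  have hl : ∀ j : Fin m, Fin.castAdd 3 j ∈ univ.filter (fun g => splitColoring S c g = i) ↔
      (if j ∈ S then (1 : Fin 3) else 2) = i := by
    intro j
    rw [mem_filter, splitColoring, Fin.addCases_left]
    simp
  have hr : ∀ k : Fin 3, Fin.natAdd m k ∈ univ.filter (fun g => splitColoring S c g = i) ↔
      c k = i := by
    intro k
    rw [mem_filter, splitColoring, Fin.addCases_right]
    simp
  rw [setW_eq_add_last_three]
  simp only [hl, hr]

/-- in the instance built from positive reals `w₁,…,w_m` (with
`T = (1/2)·Σ w_j`, two extra goods of weight `3T` and one of weight `4T`) with three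
agents of valuation parameters `v = (1,0,0)`, a `(1/4)`-approximately MMS 3-partition of
social welfare at least `10T` exists iff the `w_j` admit a subset summing to `T`. -/
theorem stmt14 {m : ℕ} (w' : Fin m → ℝ) (hw' : ∀ j, 0 < w' j)
    (T : ℝ) (hT : T = (1 / 2) * ∑ j, w' j)
    (W : Fin (m + 3) → ℝ)
    (hW : ∀ j : Fin (m + 3), W j =
      if h : (j : ℕ) < m then w' ⟨j, h⟩
      else if (j : ℕ) = m then 3 * T
      else if (j : ℕ) = m + 1 then 3 * T
      else 4 * T)
    (μ : ℝ) (hμ : IsMaximinShare (n := 3) W μ) :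
    (∃ A : Fin 3 → Finset (Fin (m + 3)), IsPartition A ∧
        (∀ i, setW W (A i) ≥ μ / 4) ∧
        1 * setW W (A 0) + 0 * setW W (A 1) + 0 * setW W (A 2) ≥ 10 * T) ↔
      ∃ S : Finset (Fin m), ∑ j ∈ S, w' j = T := by
  have hs : ∀ j : Fin m, W (Fin.castAdd 3 j) = w' j := by
    intro j
    simp [hW]
  have h0 : W (Fin.natAdd m 0) = 3 * T := by simp [hW]
  have h1 : W (Fin.natAdd m 1) = 3 * T := by simp [hW]
  have h2 : W (Fin.natAdd m 2) = 4 * T := by simp [hW]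
  have hsum : ∑ j, w' j = 2 * T := by linarith
  have hTnn : 0 ≤ T := by
    have := Finset.sum_nonneg (fun j (_ : j ∈ univ) => (hw' j).le)
    linarith
  have htotal : ∑ g, W g = 12 * T := by
    rw [Fin.sum_univ_add, Fin.sum_univ_three, h0, h1, h2]
    simp only [hs, hsum]
    ring
  have hclass : ∀ (S : Finset (Fin m)) (c : Fin 3 → Fin 3),
      setW W (univ.filter (fun g => splitColoring S c g = 0)) =
        (if c 0 = 0 then 3 * T else 0) + (if c 1 = 0 then 3 * T else 0)
          + (if c 2 = 0 then 4 * T else 0) ∧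
      setW W (univ.filter (fun g => splitColoring S c g = 1)) = ∑ j ∈ S, w' j +
        ((if c 0 = 1 then 3 * T else 0) + (if c 1 = 1 then 3 * T else 0)
          + (if c 2 = 1 then 4 * T else 0)) ∧
      setW W (univ.filter (fun g => splitColoring S c g = 2)) = (2 * T - ∑ j ∈ S, w' j) +
        ((if c 0 = 2 then 3 * T else 0) + (if c 1 = 2 then 3 * T else 0)
          + (if c 2 = 2 then 4 * T else 0)) := by
    intro S c
    have hcompl : ∑ j ∈ Sᶜ, w' j = 2 * T - ∑ j ∈ S, w' j := by
      rw [← hsum, ← Finset.sum_add_sum_compl S]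
      ring
    have e0 : univ.filter (fun j : Fin m => (if j ∈ S then (1 : Fin 3) else 2) = 0) = ∅ := by
      ext j
      by_cases hj : j ∈ S <;> simp [hj]
    have e1 : univ.filter (fun j : Fin m => (if j ∈ S then (1 : Fin 3) else 2) = 1) = S := by
      ext j
      by_cases hj : j ∈ S <;> simp [hj]
    have e2 : univ.filter (fun j : Fin m => (if j ∈ S then (1 : Fin 3) else 2) = 2) = Sᶜ := by
      ext j
      by_cases hj : j ∈ S <;> simp [hj]
    refine ⟨?_, ?_, ?_⟩
    · rw [setW_splitColoring, e0, h0, h1, h2, Finset.sum_empty, zero_add]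
    · rw [setW_splitColoring, e1, h0, h1, h2]
      simp only [hs]
    · rw [setW_splitColoring, e2, h0, h1, h2]
      simp only [hs, hcompl]
  have hμ_ge : ∀ S : Finset (Fin m), ∑ j ∈ S, w' j ≤ T → 3 * T + ∑ j ∈ S, w' j ≤ μ := by
    intro S hS
    obtain ⟨i, hi⟩ := hμ.2 _ (isPartition_colorClasses (splitColoring S ![1, 2, 0]))
    obtain ⟨c0, c1, c2⟩ := hclass S ![1, 2, 0]
    simp at c0 c1 c2
    fin_cases i <;> simp at hi <;> linarith
  have hμ_le : μ ≤ 4 * T := by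
    obtain ⟨P, hP, hPμ⟩ := hμ.1
    have := hP.sum_setW W
    rw [Fin.sum_univ_three, htotal] at this
    linarith [hPμ 0, hPμ 1, hPμ 2]
  constructor
  · rintro ⟨A, hA, hAμ, hAw⟩
    rcases hTnn.eq_or_lt with hT0 | hTpos
    · exact ⟨∅, by simp [← hT0]⟩
    have hAsum := hA.sum_setW W
    rw [Fin.sum_univ_three, htotal] at hAsum
    have hWnn : ∀ B, 0 ≤ setW W B := by
      intro B
      rw [setW_eq_add_last_three, h0, h1, h2]
      have := Finset.sum_nonneg (fun j
        (_ : j ∈ univ.filter (fun j : Fin m => Fin.castAdd 3 j ∈ B)) => (hw' j).le)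
      simp only [hs]
      positivity
    have hsmall : ∀ B, setW W B ≤ T → μ / 4 ≤ setW W B →
        ∃ S : Finset (Fin m), ∑ j ∈ S, w' j = T := by
      intro B hB hBμ
      rw [setW_eq_add_last_three, h0, h1, h2] at hB hBμ
      simp only [hs] at hB hBμ
      have hnn := Finset.sum_nonneg (fun j
        (_ : j ∈ univ.filter (fun j : Fin m => Fin.castAdd 3 j ∈ B)) => (hw' j).le)
      refine ⟨univ.filter (fun j : Fin m => Fin.castAdd 3 j ∈ B), ?_⟩
      have hμB := hμ_ge (univ.filter (fun j : Fin m => Fin.castAdd 3 j ∈ B))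
      split_ifs at hB hBμ <;> first
        | linarith
        | linarith [hμB (by linarith)]
    rcases le_total (setW W (A 1)) T with h | h
    · exact hsmall _ h (hAμ 1)
    · exact hsmall (A 2) (by linarith) (hAμ 2)
  · rintro ⟨S, hS⟩
    obtain ⟨c0, c1, c2⟩ := hclass S ![0, 0, 0]
    simp [hS] at c0 c1 c2
    refine ⟨_, isPartition_colorClasses (splitColoring S ![0, 0, 0]), fun i => ?_, ?_⟩
    · fin_cases i <;> simp <;> linarith
    · simp
      linarith
end

section
/- For any finite set of goods [m] and any n agents with additive nonnegative valuations v_1,...,v_n (each v_i assigns a nonnegative real to every good, extended additively to sets), there exists an allocation (S_1,...,S_n) of the goods (pairwise disjoint bundles whose union is [m]) satisfying the EF1 condition: for every pair of agents i,j with S_j nonempty there exists a good g ∈ S_j with v_i(S_i) ≥ v_i(S_j) − v_i(g). -/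
open Finset

/-- `S` is an allocation of the goods in `A` that is envy-free up to one good. -/
def IsEF1On {ι α : Type*} [Fintype ι] [DecidableEq α] (v : ι → α → ℝ) (A : Finset α)
    (S : ι → Finset α) : Prop :=
  (∀ i j, i ≠ j → Disjoint (S i) (S j)) ∧ Finset.univ.biUnion S = A ∧
    ∀ i j, (S j).Nonempty → ∃ g ∈ S j, ∑ x ∈ S i, v i x ≥ (∑ x ∈ S j, v i x) - v i g

/-- A self-map of a nonempty finite type has a permutation that at each point either agrees with
the map or fixes the point, and that agrees with it somewhere. -/
theorem exists_perm_eq_or_fixed {ι : Type*} [Finite ι] [Nonempty ι] (f : ι → ι) :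
    ∃ σ : Equiv.Perm ι, (∀ x, σ x = f x ∨ σ x = x) ∧ ∃ x, σ x = f x := by
  classical
  have hbij := Function.bijOn_periodicPts f
  let g : ι → ι := fun x => if x ∈ Function.periodicPts f then f x else x
  have hg : Function.Injective g := by
    intro x y hxy
    by_cases hx : x ∈ Function.periodicPts f <;> by_cases hy : y ∈ Function.periodicPts f <;>
      simp only [g, hx, hy, if_true, if_false] at hxy
    · exact hbij.injOn hx hy hxy
    · exact absurd (hxy ▸ hbij.mapsTo hx) hy
    · exact absurd (hxy ▸ hbij.mapsTo hy) hx
    · exact hxy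
  obtain ⟨x, hx⟩ : ∃ x, x ∈ Function.periodicPts f := by
    obtain ⟨x₀⟩ := ‹Nonempty ι›
    obtain ⟨a, b, hab, h⟩ := Finite.exists_ne_map_eq_of_infinite fun k : ℕ => f^[k] x₀
    wlog hlt : a < b generalizing a b
    · exact this b a hab.symm h.symm (by omega)
    refine ⟨f^[a] x₀, Function.mk_mem_periodicPts (n := b - a) (by omega) ?_⟩
    change f^[b - a] (f^[a] x₀) = f^[a] x₀
    rw [← Function.iterate_add_apply, Nat.sub_add_cancel hlt.le]
    exact h.symm
  refine ⟨Equiv.ofBijective g (Finite.injective_iff_bijective.mp hg), fun y => ?_, x, ?_⟩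
  · by_cases hy : y ∈ Function.periodicPts f <;> simp [g, hy]
  · simp [g, hx]

/-- If an EF1 allocation exists, then one exists with an agent whom nobody envies. -/
theorem IsEF1On.exists_unenvied {ι α : Type*} [Fintype ι] [Nonempty ι] [Fintype α]
    [DecidableEq α] {v : ι → α → ℝ} {A : Finset α} {S : ι → Finset α} (hS : IsEF1On v A S) :
    ∃ T, IsEF1On v A T ∧ ∃ k, ∀ i, ∑ x ∈ T k, v i x ≤ ∑ x ∈ T i, v i x := by
  classical
  obtain ⟨T, hT, hmax⟩ := Set.exists_max_image {T | IsEF1On v A T}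
    (fun T => ∑ i, ∑ x ∈ T i, v i x) (Set.toFinite _) ⟨S, hS⟩
  refine ⟨T, hT, ?_⟩
  by_contra! henvy
  choose f hf using henvy
  obtain ⟨σ, hσ, y, hy⟩ := exists_perm_eq_or_fixed f
  have hle : ∀ i, ∑ x ∈ T i, v i x ≤ ∑ x ∈ T (σ.symm i), v i x := by
    intro i
    obtain ⟨j, rfl⟩ := σ.surjective i
    rw [Equiv.symm_apply_apply]
    rcases hσ j with h | h
    · rw [h]
      exact (hf j).le
    · rw [h]
  have hEF1 : IsEF1On v A (T ∘ σ.symm) := by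
    obtain ⟨hdisj, hunion, hef⟩ := hT
    refine ⟨fun i j hij => hdisj _ _ (σ.symm.injective.ne hij), ?_, fun i j hj => ?_⟩
    · rw [← hunion]
      ext a
      simp only [mem_biUnion, mem_univ, true_and, Function.comp_apply]
      exact (σ.symm.surjective.exists (p := fun i => a ∈ T i)).symm
    · obtain ⟨g, hg, h⟩ := hef i (σ.symm j) hj
      exact ⟨g, hg, h.trans (hle i)⟩
  refine (hmax _ hEF1).not_gt (Finset.sum_lt_sum (fun i _ => hle i) ⟨f y, mem_univ _, ?_⟩)
  rw [Function.comp_apply, ← hy, Equiv.symm_apply_apply, hy]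
  exact hf y

/-- Giving a new good to an agent whom nobody envies keeps an allocation EF1. -/
theorem IsEF1On.update_insert {ι α : Type*} [Fintype ι] [DecidableEq ι] [DecidableEq α]
    {v : ι → α → ℝ} (hv : ∀ i g, 0 ≤ v i g) {A : Finset α} {S : ι → Finset α}
    (hS : IsEF1On v A S) {a : α} (ha : a ∉ A) {k : ι}
    (hk : ∀ i, ∑ x ∈ S k, v i x ≤ ∑ x ∈ S i, v i x) :
    IsEF1On v (insert a A) (Function.update S k (insert a (S k))) := by
  obtain ⟨hdisj, hunion, hef⟩ := hS
  have haS : ∀ i, a ∉ S i := fun i h =>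
    ha (hunion ▸ mem_biUnion.mpr ⟨i, mem_univ i, h⟩)
  have hmono : ∀ i, ∑ x ∈ S i, v i x ≤
      ∑ x ∈ Function.update S k (insert a (S k)) i, v i x := by
    intro i
    refine sum_le_sum_of_subset_of_nonneg ?_ fun x _ _ => hv i x
    rcases eq_or_ne i k with rfl | h
    · simp
    · simp [h]
  refine ⟨fun i j hij => ?_, ?_, fun i j hj => ?_⟩
  · rcases eq_or_ne i k with rfl | hi
    · simp [hij.symm, haS, hdisj i j hij]
    · rcases eq_or_ne j k with rfl | hj
      · simp [hi, haS, hdisj i j hij]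
      · simp [hi, hj, hdisj i j hij]
  · ext b
    simp only [← hunion, mem_biUnion, mem_univ, true_and, mem_insert]
    constructor
    · rintro ⟨i, hi⟩
      rcases eq_or_ne i k with rfl | h
      · rw [Function.update_self, mem_insert] at hi
        exact hi.imp_right fun h => ⟨i, h⟩
      · rw [Function.update_of_ne h] at hi
        exact Or.inr ⟨i, hi⟩
    · rintro (rfl | ⟨i, hi⟩)
      · exact ⟨k, by simp⟩
      · refine ⟨i, ?_⟩
        rcases eq_or_ne i k with rfl | h
        · simp [hi]
        · simpa [h] using hi
  · rcases eq_or_ne j k with rfl | h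
    · refine ⟨a, by simp, ?_⟩
      have h₁ := hmono i
      have h₂ := hk i
      rw [Function.update_self (f := S), sum_insert (haS j)]
      linarith
    · rw [Function.update_of_ne h] at hj ⊢
      obtain ⟨g, hg, h'⟩ := hef i j hj
      exact ⟨g, hg, h'.trans (hmono i)⟩

/-- Every finite set of goods has an EF1 allocation. -/
theorem exists_isEF1On {ι α : Type*} [Fintype ι] [Nonempty ι] [Fintype α] [DecidableEq α]
    {v : ι → α → ℝ} (hv : ∀ i g, 0 ≤ v i g) (A : Finset α) : ∃ S, IsEF1On v A S := by
  classical
  induction A using Finset.induction_on with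
  | empty => exact ⟨fun _ => ∅, by simp [IsEF1On, Finset.ext_iff]⟩
  | insert a A ha ih =>
    obtain ⟨S, hS⟩ := ih
    obtain ⟨T, hT, k, hk⟩ := hS.exists_unenvied
    exact ⟨_, hT.update_insert hv ha hk⟩

/-- for any goods `[m]` and any `n ≥ 1` agents with additive nonnegative
valuations, an EF1 allocation exists. -/
theorem stmt15 {m n : ℕ} (hn : 1 ≤ n) (v : Fin n → Fin m → ℝ)
    (hv : ∀ i g, 0 ≤ v i g) :
    ∃ S : Fin n → Finset (Fin m), IsPartition S ∧
      ∀ i j, (S j).Nonempty → ∃ g ∈ S j,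
        ∑ x ∈ S i, v i x ≥ (∑ x ∈ S j, v i x) - v i g := by
  have : Nonempty (Fin n) := ⟨⟨0, hn⟩⟩
  obtain ⟨S, hdisj, hunion, hef⟩ := exists_isEF1On hv Finset.univ
  exact ⟨S, ⟨hdisj, hunion⟩, hef⟩
end
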